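/- arXiv:2012.04696 — 4 statements merged into one kernel-verified Lean document; each statement's English description precedes it below -/
import Mathlib

section
/- The function ρ defined through Kepler's equation is the regularized degenerate (rectilinear) Keplerian collision orbit: for every t ∈ ℝ \ 2πℤ one has ρ(t) > 0, ρ is twice differentiable at t with ρ''(t) = −1/ρ(t)², and its energy is constant: (ρ'(t))²/2 − 1/ρ(t) = −1/2. -/
/- STATEMENT 3: `ρ` is the regularized rectilinear Keplerian collision orbit:
outside the collision times `2πℤ` it is positive, twice differentiable with
`ρ'' = −1/ρ²`, and its energy equals `−1/2`. -/

open Real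

/-- The inverse of Kepler's equation `u ↦ u - sin u`. -/
noncomputable def keplerE : ℝ → ℝ := Function.invFun (fun u : ℝ => u - Real.sin u)

/-- The regularized degenerate Keplerian collision orbit of the primaries. -/
noncomputable def primRho (t : ℝ) : ℝ := 1 - Real.cos (keplerE t)

theorem kepler_strictMono : StrictMono (fun u : ℝ => u - Real.sin u) := by
  intro x y hxy
  have h0 : 0 < (y - x) / 2 := by linarith
  have h1 : |Real.sin ((y - x) / 2)| < (y - x) / 2 := by
    have := Real.abs_sin_lt_abs h0.ne'
    rwa [abs_of_pos h0] at this
  have h2 := Real.sin_sub_sin y x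
  have h3 : Real.sin ((y - x) / 2) * Real.cos ((y + x) / 2) ≤ |Real.sin ((y - x) / 2)| := by
    refine (le_abs_self _).trans ?_
    rw [abs_mul]
    exact mul_le_of_le_one_right (abs_nonneg _) (Real.abs_cos_le_one _)
  show x - Real.sin x < y - Real.sin y
  nlinarith

theorem kepler_surj : Function.Surjective (fun u : ℝ => u - Real.sin u) := by
  apply Continuous.surjective (by fun_prop)
  · refine Filter.tendsto_atTop_mono (f := fun u : ℝ => u - 1) (fun u => ?_)
      (Filter.tendsto_atTop_add_const_right _ _ Filter.tendsto_id)
    have := Real.sin_le_one u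
    show u - 1 ≤ u - Real.sin u
    linarith
  · refine Filter.tendsto_atBot_mono (f := fun u : ℝ => u + 1) (fun u => ?_)
      (Filter.tendsto_atBot_add_const_right _ _ Filter.tendsto_id)
    have := Real.neg_one_le_sin u
    show u - Real.sin u ≤ u + 1
    linarith

theorem keplerE_right (t : ℝ) : keplerE t - Real.sin (keplerE t) = t :=
  Function.rightInverse_invFun kepler_surj t

theorem keplerE_left (u : ℝ) : keplerE (u - Real.sin u) = u :=
  Function.leftInverse_invFun kepler_strictMono.injective u

theorem keplerE_continuous : Continuous keplerE := by
  apply Monotone.continuous_of_surjective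
  · intro a b hab
    rw [← kepler_strictMono.le_iff_le]
    simpa only [keplerE_right] using hab
  · intro u
    exact ⟨_, keplerE_left u⟩

theorem keplerE_hasDerivAt (t : ℝ) (h : 1 - Real.cos (keplerE t) ≠ 0) :
    HasDerivAt keplerE (1 - Real.cos (keplerE t))⁻¹ t := by
  refine HasDerivAt.of_local_left_inverse (f := fun u : ℝ => u - Real.sin u)
    keplerE_continuous.continuousAt ?_ h (Filter.Eventually.of_forall keplerE_right)
  exact (hasDerivAt_id _).sub (Real.hasDerivAt_sin _)

theorem primRho_hasDerivAt (t : ℝ) (h : 1 - Real.cos (keplerE t) ≠ 0) :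
    HasDerivAt primRho (Real.sin (keplerE t) / (1 - Real.cos (keplerE t))) t := by
  have := ((keplerE_hasDerivAt t h).cos).const_sub 1
  refine this.congr_deriv ?_
  rw [div_eq_mul_inv]
  ring

theorem primRho_hasDerivAt2 (t : ℝ) (h : 1 - Real.cos (keplerE t) ≠ 0) :
    HasDerivAt (deriv primRho) (-1 / (1 - Real.cos (keplerE t)) ^ 2) t := by
  have hE := keplerE_hasDerivAt t h
  have h1 := (hE.sin).div ((hE.cos).const_sub 1) h
  have hev : deriv primRho =ᶠ[nhds t]
      fun s => Real.sin (keplerE s) / (1 - Real.cos (keplerE s)) := by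
    have hc : ContinuousAt (fun s => 1 - Real.cos (keplerE s)) t := by
      have := keplerE_continuous
      fun_prop
    filter_upwards [hc.eventually_ne h] with s hs
    exact (primRho_hasDerivAt s hs).deriv
  refine (HasDerivAt.congr_of_eventuallyEq h1 hev).congr_deriv ?_
  have h2 := Real.sin_sq_add_cos_sq (keplerE t)
  field_simp
  linear_combination -h2

theorem rho_is_collision_orbit (t : ℝ) (ht : ∀ k : ℤ, t ≠ 2 * Real.pi * k) :
    0 < primRho t ∧
    DifferentiableAt ℝ primRho t ∧
    DifferentiableAt ℝ (deriv primRho) t ∧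
    deriv (deriv primRho) t = -1 / (primRho t) ^ 2 ∧
    (deriv primRho t) ^ 2 / 2 - 1 / primRho t = -1 / 2 := by
  have h0 : 1 - Real.cos (keplerE t) ≠ 0 := by
    intro h
    have h1 : Real.cos (keplerE t) = 1 := by linarith
    obtain ⟨k, hk⟩ := (Real.cos_eq_one_iff _).1 h1
    have h2 := keplerE_right t
    have h3 : Real.sin (keplerE t) = 0 := by
      have := Real.sin_sq_add_cos_sq (keplerE t)
      rw [h1] at this
      nlinarith
    apply ht k
    rw [h3] at h2
    linarith
  have hd := primRho_hasDerivAt t h0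
  have hd2 := primRho_hasDerivAt2 t h0
  refine ⟨?_, hd.differentiableAt, hd2.differentiableAt, hd2.deriv, ?_⟩
  · have := Real.cos_le_one (keplerE t)
    exact lt_of_le_of_ne (by unfold primRho; linarith) (Ne.symm h0)
  · rw [hd.deriv]
    unfold primRho
    have h2 := Real.sin_sq_add_cos_sq (keplerE t)
    field_simp
    linear_combination h2
end

section
/- There exists G₀ ≥ 1 such that for all integers l ≥ 1 and k ≥ 1 and all G ≥ G₀, the oscillatory integral I(l,k;G) = ∫_{−∞}^{∞} e^{i l G³(τ + τ³/3)/2} (1+τ²)^{−2k} dτ satisfies |I(l,k;G)| ≤ 8·e^{l}·G^{3k − 3/2}·e^{−l G³/3}. -/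
/- STATEMENT 9: exponentially small bound for the oscillatory integrals
`I(l,k;G)` for `l ≥ 1`, `k ≥ 1` and `G` large. -/

open Real MeasureTheory

/-- The oscillatory integral `I(l,k;G) = ∫ e^{ilG³(τ+τ³/3)/2} (1+τ²)^{−2k} dτ`. -/
noncomputable def oscInt (G : ℝ) (l : ℤ) (k : ℕ) : ℂ :=
  ∫ τ : ℝ, Complex.exp (Complex.I * l * G ^ 3 * (τ + τ ^ 3 / 3) / 2) *
    (((1 + τ ^ 2) ^ (2 * k) : ℝ) : ℂ)⁻¹

open Filter Topology

noncomputable def oscAux (A : ℝ) (k : ℕ) (z : ℂ) : ℂ :=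
  Complex.exp (Complex.I * A * (z + z ^ 3 / 3) / 2) * ((1 + z ^ 2) ^ (2 * k))⁻¹

lemma oscAux_exp (A x y : ℝ) :
    ‖Complex.exp (Complex.I * A * ((x + y * Complex.I : ℂ) + (x + y * Complex.I : ℂ) ^ 3 / 3) / 2)‖
      = Real.exp (-(A / 2) * (y + x ^ 2 * y - y ^ 3 / 3)) := by
  rw [Complex.norm_exp]
  congr 1
  have : (Complex.I * A * ((x + y * Complex.I : ℂ) + (x + y * Complex.I : ℂ) ^ 3 / 3) / 2)
      = ((-(A / 2) * (y + x ^ 2 * y - y ^ 3 / 3) : ℝ) : ℂ)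
        + ((A / 2 * (x + x ^ 3 / 3 - x * y ^ 2) : ℝ) : ℂ) * Complex.I := by
    push_cast
    have h2 : Complex.I ^ 2 = -1 := Complex.I_sq
    have h3 : Complex.I ^ 3 = -Complex.I := Complex.I_pow_three
    have h4 : Complex.I ^ 4 = 1 := Complex.I_pow_four
    ring_nf
    simp only [h2, h3, h4]
    ring
  rw [this]; simp only [Complex.add_re, Complex.ofReal_re, Complex.re_ofReal_mul, Complex.I_re, mul_zero, add_zero]

lemma oscAux_den_sq (x y : ℝ) :
    ‖(1 + (x + y * Complex.I : ℂ) ^ 2)‖ ^ 2 = (x ^ 2 + (1 - y) ^ 2) * (x ^ 2 + (1 + y) ^ 2) := by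
  have : (1 + (x + y * Complex.I : ℂ) ^ 2) = ((1 + x ^ 2 - y ^ 2 : ℝ) : ℂ)
        + ((2 * x * y : ℝ) : ℂ) * Complex.I := by
    push_cast
    have h2 : Complex.I ^ 2 = -1 := Complex.I_sq
    ring_nf
    simp only [h2]
    ring
  rw [this, Complex.sq_norm, Complex.normSq_add_mul_I]
  ring

lemma oscAux_den1 (x y : ℝ) (h0 : 0 ≤ y) (h1 : y ≤ 1) :
    1 - y ≤ ‖(1 + (x + y * Complex.I : ℂ) ^ 2)‖ := by
  apply le_of_sq_le_sq _ (norm_nonneg _)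
  rw [oscAux_den_sq]
  nlinarith [sq_nonneg x, sq_nonneg (1 - y), mul_nonneg (sq_nonneg x) (sq_nonneg x),
    mul_nonneg (sq_nonneg x) (sq_nonneg (1 - y)), mul_nonneg (sq_nonneg x) (sq_nonneg (1 + y)),
    mul_nonneg h0 (sq_nonneg (1 - y)), mul_nonneg (mul_nonneg h0 h0) (sq_nonneg (1 - y))]

lemma oscAux_den2 (x y : ℝ) :
    x ^ 2 ≤ ‖(1 + (x + y * Complex.I : ℂ) ^ 2)‖ := by
  apply le_of_sq_le_sq _ (norm_nonneg _)
  rw [oscAux_den_sq]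
  nlinarith [mul_nonneg (sq_nonneg x) (sq_nonneg (1 - y)), mul_nonneg (sq_nonneg x)
    (sq_nonneg (1 + y)), mul_nonneg (sq_nonneg (1-y)) (sq_nonneg (1 + y))]

lemma oscAux_diff (A : ℝ) (k : ℕ) (z : ℂ) (h0 : 0 ≤ z.im) (h1 : z.im < 1) :
    DifferentiableAt ℂ (oscAux A k) z := by
  have hz : 1 + z ^ 2 ≠ 0 := by
    have := oscAux_den1 z.re z.im h0 h1.le
    rw [Complex.re_add_im] at this
    rw [← norm_pos_iff]
    linarith
  unfold oscAux
  have : (1 + z ^ 2) ^ (2 * k) ≠ 0 := pow_ne_zero _ hz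
  fun_prop (disch := assumption)

lemma oscAux_norm (A : ℝ) (k : ℕ) (x y : ℝ) : ‖oscAux A k (x + y * Complex.I)‖ =
    Real.exp (-(A / 2) * (y + x ^ 2 * y - y ^ 3 / 3)) *
      (‖(1 + (x + y * Complex.I : ℂ) ^ 2)‖ ^ (2 * k))⁻¹ := by
  unfold oscAux
  rw [norm_mul, oscAux_exp, norm_inv, norm_pow]

lemma oscAux_vert (A : ℝ) (hA : 0 ≤ A) (k : ℕ) (hk : 1 ≤ k) (x y : ℝ) (hx : 1 ≤ x ^ 2)
    (h0 : 0 ≤ y) (h1 : y ≤ 1) : ‖oscAux A k (x + y * Complex.I)‖ ≤ (x ^ 2)⁻¹ := by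
  rw [oscAux_norm]
  have e : Real.exp (-(A / 2) * (y + x ^ 2 * y - y ^ 3 / 3)) ≤ 1 := by
    rw [Real.exp_le_one_iff]
    have : 0 ≤ y + x ^ 2 * y - y ^ 3 / 3 := by
      have : y ^ 3 ≤ y := by
        calc y ^ 3 ≤ y ^ 1 := pow_le_pow_of_le_one h0 h1 (by norm_num)
          _ = y := pow_one y
      nlinarith [mul_nonneg (sq_nonneg x) h0]
    nlinarith
  have d : (‖(1 + (x + y * Complex.I : ℂ) ^ 2)‖ ^ (2 * k))⁻¹ ≤ (x ^ 2)⁻¹ := by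
    apply inv_anti₀ (by linarith)
    calc x ^ 2 ≤ (x ^ 2) ^ (2 * k) := le_self_pow₀ hx (by omega)
      _ ≤ _ := pow_le_pow_left₀ (sq_nonneg x) (oscAux_den2 x y) _
  calc _ ≤ 1 * (x ^ 2)⁻¹ := by gcongr
    _ = _ := one_mul _

lemma oscAux_horiz (A : ℝ) (hA : 0 ≤ A) (k : ℕ) (d : ℝ) (hd : 0 < d) (hd2 : d ≤ 1 / 2) (x : ℝ) :
    ‖oscAux A k (x + (1 - d : ℝ) * Complex.I)‖ ≤
      Real.exp (-A / 3 + A * d ^ 2 / 2) * (d ^ (2 * k))⁻¹ * Real.exp (-(A / 4) * x ^ 2) := by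
  rw [oscAux_norm]
  have e : Real.exp (-(A / 2) * ((1 - d) + x ^ 2 * (1 - d) - (1 - d) ^ 3 / 3)) ≤
      Real.exp (-A / 3 + A * d ^ 2 / 2) * Real.exp (-(A / 4) * x ^ 2) := by
    rw [← Real.exp_add, Real.exp_le_exp]
    have h1 : 0 ≤ A * d ^ 3 := by positivity
    have h2 : 0 ≤ A * x ^ 2 * (1 / 2 - d) := mul_nonneg (by positivity) (by linarith)
    nlinarith
  have d' : (‖(1 + (x + (1 - d : ℝ) * Complex.I : ℂ) ^ 2)‖ ^ (2 * k))⁻¹ ≤ (d ^ (2 * k))⁻¹ := by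
    apply inv_anti₀ (by positivity)
    have := oscAux_den1 x (1 - d) (by linarith) (by linarith)
    exact pow_le_pow_left₀ hd.le (by linarith) _
  calc _ ≤ (Real.exp (-A / 3 + A * d ^ 2 / 2) * Real.exp (-(A / 4) * x ^ 2)) * (d ^ (2 * k))⁻¹ := by
        gcongr
    _ = _ := by ring

lemma oscAux_cont (A : ℝ) (k : ℕ) (y : ℝ) (h0 : 0 ≤ y) (h1 : y < 1) :
    Continuous fun x : ℝ => oscAux A k (x + y * Complex.I) := by
  rw [continuous_iff_continuousAt]
  intro x
  have := (oscAux_diff A k (x + y * Complex.I) (by simpa using h0) (by simpa using h1)).continuousAt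
  exact ContinuousAt.comp (f := fun x : ℝ => (x + y * Complex.I : ℂ)) this (by fun_prop)

lemma oscAux_int0 (A : ℝ) (k : ℕ) (hk : 1 ≤ k) :
    Integrable fun x : ℝ => oscAux A k (x + (0 : ℝ) * Complex.I) := by
  refine integrable_inv_one_add_sq.mono' (oscAux_cont A k 0 le_rfl one_pos).aestronglyMeasurable ?_
  refine Eventually.of_forall fun x => ?_
  rw [oscAux_norm]
  have h : ‖(1 + (x + (0 : ℝ) * Complex.I : ℂ) ^ 2)‖ = 1 + x ^ 2 := by
    have : (1 + (x + (0 : ℝ) * Complex.I : ℂ) ^ 2) = ((1 + x ^ 2 : ℝ) : ℂ) := by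
      push_cast; ring
    rw [this, Complex.norm_real, Real.norm_of_nonneg (by positivity)]
  rw [h]
  simp only [mul_zero, add_zero]
  norm_num
  apply inv_anti₀ (by positivity)
  exact le_self_pow₀ (by nlinarith [sq_nonneg x]) (by omega)

lemma oscAux_int1 (A : ℝ) (hA : 0 < A) (k : ℕ) (d : ℝ) (hd : 0 < d) (hd2 : d ≤ 1 / 2) :
    Integrable fun x : ℝ => oscAux A k (x + (1 - d : ℝ) * Complex.I) := by
  refine ((integrable_exp_neg_mul_sq (b := A / 4) (by positivity)).const_mul
    (Real.exp (-A / 3 + A * d ^ 2 / 2) * (d ^ (2 * k))⁻¹)).mono'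
    (oscAux_cont A k (1 - d) (by linarith) (by linarith)).aestronglyMeasurable ?_
  exact Eventually.of_forall fun x => oscAux_horiz A hA.le k d hd hd2 x

lemma oscAux_shift (A : ℝ) (hA : 0 < A) (k : ℕ) (hk : 1 ≤ k) (d : ℝ) (hd : 0 < d)
    (hd2 : d ≤ 1 / 2) :
    ∫ x : ℝ, oscAux A k (x + (0 : ℝ) * Complex.I) =
      ∫ x : ℝ, oscAux A k (x + (1 - d : ℝ) * Complex.I) := by
  have t0 := intervalIntegral_tendsto_integral (oscAux_int0 A k hk) tendsto_neg_atTop_atBot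
    tendsto_id
  have t1 := intervalIntegral_tendsto_integral (oscAux_int1 A hA k d hd hd2)
    tendsto_neg_atTop_atBot tendsto_id
  have t := t0.sub t1
  have key : Tendsto (fun R : ℝ => (∫ x in (-R)..(id R), oscAux A k (x + (0 : ℝ) * Complex.I)) -
      ∫ x in (-R)..(id R), oscAux A k (x + (1 - d : ℝ) * Complex.I)) atTop (𝓝 0) := by
    have lim : Tendsto (fun R : ℝ => 2 * (R ^ 2)⁻¹) atTop (𝓝 0) := by
      have := (tendsto_inv_atTop_zero.comp (tendsto_pow_atTop (α := ℝ) (n := 2) two_ne_zero)).const_mul 2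
      simpa using this
    refine squeeze_zero_norm' ?_ lim
    filter_upwards [eventually_ge_atTop (1 : ℝ)] with R hR
    have c := Complex.integral_boundary_rect_eq_zero_of_differentiableOn (oscAux A k)
      ((-R : ℝ) : ℂ) ((R : ℂ) + (1 - d : ℝ) * Complex.I) (by
        intro z hz
        apply DifferentiableAt.differentiableWithinAt
        have h := hz.2
        simp only [Set.mem_preimage, Complex.ofReal_im, Complex.add_im, Complex.im_ofReal_mul,
          Complex.I_im, mul_one, zero_add] at h
        rw [Set.uIcc_of_le (by linarith)] at h
        exact oscAux_diff A k z h.1 (by linarith [h.2]))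
    simp only [Complex.ofReal_im, Complex.ofReal_re, Complex.add_im, Complex.add_re,
      Complex.im_ofReal_mul, Complex.re_ofReal_mul, Complex.I_re, mul_zero, add_zero,
      Complex.I_im, mul_one, zero_add] at c
    have b : ∀ S : ℝ, S ^ 2 = R ^ 2 →
        ‖∫ y in (0 : ℝ)..(1 - d), oscAux A k (S + y * Complex.I)‖ ≤ (R ^ 2)⁻¹ := by
      intro S hS
      have := intervalIntegral.norm_integral_le_of_norm_le_const (a := 0) (b := 1 - d)
        (f := fun y : ℝ => oscAux A k (S + y * Complex.I)) (C := (R ^ 2)⁻¹) (by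
          intro y hy
          rw [Set.uIoc_of_le (by linarith)] at hy
          rw [← hS]
          exact oscAux_vert A hA.le k hk S y (by rw [hS]; nlinarith) hy.1.le (by linarith [hy.2]))
      refine this.trans ?_
      rw [sub_zero, abs_of_nonneg (by linarith)]
      exact mul_le_of_le_one_right (by positivity) (by linarith)
    have b1 := b R rfl
    have b2 := b (-R) (by ring)
    have e : (∫ x in (-R)..(id R), oscAux A k (x + (0 : ℝ) * Complex.I)) -
      ∫ x in (-R)..(id R), oscAux A k (x + (1 - d : ℝ) * Complex.I) =
      Complex.I • (∫ y in (0 : ℝ)..(1 - d), oscAux A k ((-R : ℝ) + y * Complex.I)) -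
      Complex.I • (∫ y in (0 : ℝ)..(1 - d), oscAux A k (R + y * Complex.I)) := by
      simp only [id]
      linear_combination c
    rw [e]
    refine (norm_sub_le _ _).trans ?_
    rw [norm_smul, norm_smul, Complex.norm_I]
    linarith
  have := tendsto_nhds_unique t key
  exact sub_eq_zero.mp this

lemma oscAux_bound (A : ℝ) (hA : 0 < A) (k : ℕ) (hk : 1 ≤ k) (d : ℝ) (hd : 0 < d)
    (hd2 : d ≤ 1 / 2) :
    ‖∫ x : ℝ, oscAux A k (x + (0 : ℝ) * Complex.I)‖ ≤
      Real.exp (-A / 3 + A * d ^ 2 / 2) * (d ^ (2 * k))⁻¹ * √(π / (A / 4)) := by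
  rw [oscAux_shift A hA k hk d hd hd2, ← integral_gaussian, ← integral_const_mul]
  apply norm_integral_le_of_norm_le
  · exact (integrable_exp_neg_mul_sq (b := A / 4) (by positivity)).const_mul _
  · exact Eventually.of_forall fun x => oscAux_horiz A hA.le k d hd hd2 x

theorem oscillatory_integral_bound :
    ∃ G₀ : ℝ, 1 ≤ G₀ ∧ ∀ l : ℕ, 1 ≤ l → ∀ k : ℕ, 1 ≤ k → ∀ G : ℝ, G₀ ≤ G →
      ‖oscInt G l k‖ ≤
        8 * Real.exp l * G ^ ((3 * k : ℝ) - 3 / 2) * Real.exp (-(l : ℝ) * G ^ 3 / 3) := by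
  refine ⟨4, by norm_num, fun l hl k hk G hG => ?_⟩
  have hl' : (1 : ℝ) ≤ l := by exact_mod_cast hl
  have hG0 : 0 < G := by linarith
  have hA : 0 < (l : ℝ) * G ^ 3 := by positivity
  set d : ℝ := (√(G ^ 3))⁻¹ with hd
  have hs : 2 ≤ √(G ^ 3) := by
    apply Real.le_sqrt_of_sq_le
    nlinarith [sq_nonneg G, mul_pos hG0 hG0]
  have hs2 : √(G ^ 3) ^ 2 = G ^ 3 := Real.sq_sqrt (by positivity)
  have hdpos : 0 < d := by positivity
  have hd2 : d ≤ 1 / 2 := by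
    rw [hd, one_div]
    exact inv_anti₀ (by norm_num) hs
  have hdd : G ^ 3 * d ^ 2 = 1 := by
    rw [hd, inv_pow, hs2]
    exact mul_inv_cancel₀ (by positivity)
  have B := oscAux_bound ((l : ℝ) * G ^ 3) hA k hk d hdpos hd2
  have E : oscInt G l k = ∫ x : ℝ, oscAux ((l : ℝ) * G ^ 3) k (x + (0 : ℝ) * Complex.I) := by
    unfold oscInt oscAux
    congr 1
    funext x
    push_cast
    simp only [zero_mul, add_zero, mul_assoc]
  rw [E]
  refine B.trans ?_
  have r : G ^ ((3 * k : ℝ) - 3 / 2) = (d ^ (2 * k))⁻¹ * d := by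
    have h1 : d = G ^ (-(3 / 2) : ℝ) := by
      rw [hd, Real.sqrt_eq_rpow, ← Real.rpow_natCast, ← Real.rpow_mul hG0.le, ← Real.rpow_neg hG0.le]
      norm_num
    rw [h1, ← Real.rpow_natCast, ← Real.rpow_mul hG0.le, ← Real.rpow_neg hG0.le,
      ← Real.rpow_add hG0]
    congr 1
    push_cast
    ring
  have ex : Real.exp (-((l : ℝ) * G ^ 3) / 3 + (l : ℝ) * G ^ 3 * d ^ 2 / 2) ≤
      Real.exp l * Real.exp (-(l : ℝ) * G ^ 3 / 3) := by
    rw [← Real.exp_add, Real.exp_le_exp, mul_assoc (l : ℝ), hdd]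
    nlinarith
  have sq : √(π / ((l : ℝ) * G ^ 3 / 4)) ≤ 8 * d := by
    apply Real.sqrt_le_iff.mpr ⟨by positivity, ?_⟩
    rw [div_le_iff₀ (by positivity)]
    have : (8 * d) ^ 2 * ((l : ℝ) * G ^ 3 / 4) = 16 * l * (G ^ 3 * d ^ 2) := by ring
    rw [this, hdd]
    linarith [Real.pi_le_four]
  rw [r]
  calc _ ≤ (Real.exp l * Real.exp (-(l : ℝ) * G ^ 3 / 3)) * (d ^ (2 * k))⁻¹ * (8 * d) := by
        gcongr
    _ = _ := by ring
end

section
/- There exist constants C > 0 and G₀ ≥ 1 such that for all G ≥ G₀ one has |I(1,1;G) − √π·(G/2)^{3/2}·e^{−G³/3}| ≤ C·e^{−G³/3}; that is, I(1,1;G) = √π (G/2)^{3/2} e^{−G³/3}(1 + O(G^{−3/2})). -/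
/- STATEMENT 10: first-order asymptotics of the oscillatory integral
`I(1,1;G) = √π (G/2)^{3/2} e^{−G³/3}(1 + O(G^{−3/2}))`. -/

open Real MeasureTheory

open Filter Topology

theorem shift_line (f : ℂ → ℂ) (a K : ℝ) (ha : 0 ≤ a)
    (hf : ∀ z : ℂ, 0 ≤ z.im → z.im ≤ a → DifferentiableAt ℂ f z)
    (hb : ∀ x y : ℝ, 0 ≤ y → y ≤ a → ‖f (x + y * Complex.I)‖ ≤ K * (1 + x ^ 2)⁻¹) :
    (∫ x : ℝ, f x) = ∫ x : ℝ, f (x + a * Complex.I) := by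
  have hint : ∀ y : ℝ, 0 ≤ y → y ≤ a → Integrable (fun x : ℝ => f (x + y * Complex.I)) := by
    intro y h0 h1
    refine Integrable.mono' (integrable_inv_one_add_sq.const_mul K) ?_
      (Eventually.of_forall fun x => hb x y h0 h1)
    apply Continuous.aestronglyMeasurable
    rw [continuous_iff_continuousAt]
    intro x
    have := (hf (x + y * Complex.I) (by simpa using h0) (by simpa using h1)).continuousAt
    exact ContinuousAt.comp (f := fun x : ℝ => (x + y * Complex.I : ℂ)) this (by fun_prop)
  have h1 : Tendsto (fun R : ℝ => ∫ x in (-R)..R, f (x + (0:ℝ) * Complex.I)) atTop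
      (𝓝 (∫ x : ℝ, f (x + (0:ℝ) * Complex.I))) :=
    intervalIntegral_tendsto_integral (hint 0 le_rfl ha) tendsto_neg_atTop_atBot tendsto_id
  have h2 : Tendsto (fun R : ℝ => ∫ x in (-R)..R, f (x + a * Complex.I)) atTop
      (𝓝 (∫ x : ℝ, f (x + a * Complex.I))) :=
    intervalIntegral_tendsto_integral (hint a ha le_rfl) tendsto_neg_atTop_atBot tendsto_id
  have hz : Tendsto (fun R : ℝ => K * (1 + R ^ 2)⁻¹ * |a - 0|) atTop (𝓝 0) := by
    have : Tendsto (fun R : ℝ => (1 + R ^ 2)⁻¹) atTop (𝓝 0) :=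
      tendsto_inv_atTop_zero.comp
        (tendsto_atTop_add_const_left _ _ (tendsto_pow_atTop (by norm_num)))
    simpa using (this.const_mul K).mul_const |a - 0|
  have hv : ∀ R : ℝ, ‖∫ y in (0:ℝ)..a, f (R + y * Complex.I)‖ ≤ K * (1 + R ^ 2)⁻¹ * |a - 0| := by
    intro R
    apply intervalIntegral.norm_integral_le_of_norm_le_const
    intro y hy
    rw [Set.uIoc_of_le ha] at hy
    exact hb R y hy.1.le hy.2
  have h3 : Tendsto (fun R : ℝ => ∫ y in (0:ℝ)..a, f (R + y * Complex.I)) atTop (𝓝 0) :=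
    squeeze_zero_norm hv hz
  have h4 : Tendsto (fun R : ℝ => ∫ y in (0:ℝ)..a, f ((-R : ℝ) + y * Complex.I)) atTop (𝓝 0) :=
    squeeze_zero_norm (fun R => by simpa using hv (-R)) hz
  have hrect : ∀ R : ℝ, (∫ x in (-R)..R, f (x + (0:ℝ) * Complex.I)) -
      (∫ x in (-R)..R, f (x + a * Complex.I)) +
      Complex.I • (∫ y in (0:ℝ)..a, f (R + y * Complex.I)) -
      Complex.I • (∫ y in (0:ℝ)..a, f ((-R : ℝ) + y * Complex.I)) = 0 := by
    intro R
    have := Complex.integral_boundary_rect_eq_zero_of_differentiableOn f (⟨-R, 0⟩) (⟨R, a⟩) (by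
      intro z hz
      rw [Complex.mem_reProdIm] at hz
      have h := hz.2
      simp only [Set.uIcc_of_le ha] at h
      exact (hf z h.1 h.2).differentiableWithinAt)
    simpa using this
  have h5 := ((h1.sub h2).add (h3.const_smul Complex.I)).sub (h4.const_smul Complex.I)
  have h6 := tendsto_nhds_unique (h5.congr hrect) tendsto_const_nhds
  simp at h6
  exact sub_eq_zero.mp h6

theorem norm_exp_sub_one (z : ℂ) (M : ℝ) (hM : 0 ≤ M) (h : z.re ≤ M) :
    ‖Complex.exp z - 1‖ ≤ Real.exp M * ‖z‖ := by
  have := (convex_halfSpace_re_le M).norm_image_sub_le_of_norm_deriv_le (f := Complex.exp) (C := Real.exp M)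
    (x := 0) (y := z) (fun x _ => Complex.differentiableAt_exp) (by
      intro x hx
      rw [Complex.deriv_exp, Complex.norm_exp]
      exact Real.exp_le_exp.mpr hx) (by simpa using hM) h
  simpa using this

theorem phase_bound (L a x y : ℝ) (hL : 0 ≤ L) (ha : a < 1) (h0 : 0 ≤ y) (h1 : y ≤ a) :
    ‖Complex.exp (Complex.I * L * (((x + y * Complex.I : ℂ)) + (x + y * Complex.I : ℂ) ^ 3 / 3)) *
      ((1 + (x + y * Complex.I : ℂ) ^ 2) ^ 2)⁻¹‖ ≤ ((1 - a) ^ 2)⁻¹ * (1 + x ^ 2)⁻¹ := by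
  have e1 : ‖Complex.exp (Complex.I * L * (((x + y * Complex.I : ℂ)) + (x + y * Complex.I : ℂ) ^ 3 / 3))‖ ≤ 1 := by
    rw [Complex.norm_exp, Real.exp_le_one_iff]
    have : (Complex.I * L * (((x + y * Complex.I : ℂ)) + (x + y * Complex.I : ℂ) ^ 3 / 3)).re
        = -(L * (y * (1 + x ^ 2 - y ^ 2 / 3))) := by
      have : (Complex.I * L * (((x + y * Complex.I : ℂ)) + (x + y * Complex.I : ℂ) ^ 3 / 3))
        = ((-(L * (y * (1 + x ^ 2 - y ^ 2 / 3))) : ℝ) : ℂ) + ((L * (x + x^3/3 - x*y^2) : ℝ) : ℂ) * Complex.I := by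
        push_cast
        linear_combination (L * (x:ℂ)^2 * y + L * y + L*x*y^2 * Complex.I + L * y^3/3*(Complex.I^2-1)) * Complex.I_sq
      rw [this]
      simp only [Complex.add_re, Complex.re_ofReal_mul, Complex.I_re, Complex.ofReal_re, mul_zero, add_zero]
    rw [this]
    have : 0 ≤ 1 + x ^ 2 - y ^ 2 / 3 := by nlinarith
    have := mul_nonneg hL (mul_nonneg h0 this)
    linarith
  have e2 : (1 - a) ^ 2 * (1 + x ^ 2) ≤ ‖(1 + (x + y * Complex.I : ℂ) ^ 2) ^ 2‖ := by
    rw [norm_pow, ← Complex.normSq_eq_norm_sq]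
    have : (1 + (x + y * Complex.I : ℂ) ^ 2) = ((1 + x^2 - y^2 : ℝ) : ℂ) + ((2 * x * y : ℝ) : ℂ) * Complex.I := by
      push_cast
      linear_combination (y:ℂ)^2 * Complex.I_sq
    rw [this, Complex.normSq_add_mul_I]
    have : (1 + x^2 - y^2)^2 + (2*x*y)^2 = (x^2 + (1-y)^2) * (x^2 + (1+y)^2) := by ring
    rw [this]
    apply mul_le_mul _ _ (by positivity) (by positivity)
    · nlinarith
    · nlinarith
  rw [norm_mul, norm_inv]
  have hp : 0 < (1 - a) ^ 2 * (1 + x ^ 2) := by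
    have : 0 < 1 - a := by linarith
    positivity
  calc _ ≤ 1 * ((1 - a) ^ 2 * (1 + x ^ 2))⁻¹ := by gcongr
    _ = _ := by rw [one_mul, mul_inv]

theorem w_ne (u : ℝ) : ((u:ℂ) + ((-1:ℝ):ℂ) * Complex.I) ≠ 0 := by
  intro h
  have := congrArg Complex.im h
  simp at this

theorem w_normsq (u : ℝ) : ‖(u:ℂ) + ((-1:ℝ):ℂ) * Complex.I‖ ^ 2 = 1 + u ^ 2 := by
  rw [← Complex.normSq_eq_norm_sq, Complex.normSq_add_mul_I]; ring

theorem w_norm_ge (u : ℝ) : 1 ≤ ‖(u:ℂ) + ((-1:ℝ):ℂ) * Complex.I‖ := by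
  have := w_normsq u
  nlinarith [norm_nonneg ((u:ℂ) + ((-1:ℝ):ℂ) * Complex.I), sq_nonneg u]

theorem w_gauss_norm (u : ℝ) :
    ‖Complex.exp (-1 * ((u:ℂ) + ((-1:ℝ):ℂ) * Complex.I) ^ 2)‖ = Real.exp (1 - u ^ 2) := by
  rw [Complex.norm_exp]
  congr 1
  have : -1 * ((u:ℂ) + ((-1:ℝ):ℂ) * Complex.I) ^ 2 = ((1 - u ^ 2 : ℝ) : ℂ) + ((2 * u : ℝ) : ℂ) * Complex.I := by
    push_cast
    linear_combination (-1 : ℂ) * Complex.I_sq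
  rw [this]
  simp only [Complex.add_re, Complex.re_ofReal_mul, Complex.I_re, Complex.ofReal_re, mul_zero, add_zero]

theorem gauss_int : Integrable (fun u : ℝ => Complex.exp (-1 * ((u:ℂ) + ((-1:ℝ):ℂ) * Complex.I) ^ 2)) :=
  GaussianFourier.integrable_cexp_neg_mul_sq_add_real_mul_I (b := 1) (by simp) (-1)

theorem gauss_val : ∫ u : ℝ, Complex.exp (-1 * ((u:ℂ) + ((-1:ℝ):ℂ) * Complex.I) ^ 2) = (Real.sqrt π : ℝ) := by
  rw [GaussianFourier.integral_cexp_neg_mul_sq_add_real_mul_I (b := 1) (by simp) (-1)]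
  rw [Real.sqrt_eq_rpow, Complex.ofReal_cpow Real.pi_pos.le]
  norm_num

theorem h0_int : Integrable (fun u : ℝ => Complex.exp (-1 * ((u:ℂ) + ((-1:ℝ):ℂ) * Complex.I) ^ 2) *
    (((u:ℂ) + ((-1:ℝ):ℂ) * Complex.I) ^ 2)⁻¹) := by
  refine gauss_int.norm.mono' ?_ (Eventually.of_forall fun u => ?_)
  · apply Continuous.aestronglyMeasurable
    refine Continuous.mul (by fun_prop) (Continuous.inv₀ (by fun_prop) fun u => pow_ne_zero _ (w_ne u))
  · rw [norm_mul, norm_inv, norm_pow]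
    exact mul_le_of_le_one_right (norm_nonneg _) (inv_le_one_of_one_le₀ (one_le_pow₀ (w_norm_ge u)))

theorem h0_val : ∫ u : ℝ, Complex.exp (-1 * ((u:ℂ) + ((-1:ℝ):ℂ) * Complex.I) ^ 2) *
    (((u:ℂ) + ((-1:ℝ):ℂ) * Complex.I) ^ 2)⁻¹ = -2 * (Real.sqrt π : ℝ) := by
  have hd : ∀ u : ℝ, HasDerivAt (fun u : ℝ => -(Complex.exp (-1 * ((u:ℂ) + ((-1:ℝ):ℂ) * Complex.I) ^ 2) *
      ((u:ℂ) + ((-1:ℝ):ℂ) * Complex.I)⁻¹))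
      (2 * Complex.exp (-1 * ((u:ℂ) + ((-1:ℝ):ℂ) * Complex.I) ^ 2) +
        Complex.exp (-1 * ((u:ℂ) + ((-1:ℝ):ℂ) * Complex.I) ^ 2) *
    (((u:ℂ) + ((-1:ℝ):ℂ) * Complex.I) ^ 2)⁻¹) u := by
    intro u
    have hw : HasDerivAt (fun u : ℝ => (u:ℂ) + ((-1:ℝ):ℂ) * Complex.I) 1 u :=
      (Complex.ofRealCLM.hasDerivAt (x := u)).add_const _
    have := ((((hw.pow 2).const_mul (-1)).cexp).mul (hw.inv (w_ne u))).neg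
    refine this.congr_deriv ?_
    have := w_ne u
    simp only [Pi.pow_apply, Pi.inv_apply]
    field_simp
    push_cast
    ring
  have htop : ∀ l : Filter ℝ, Tendsto (fun u : ℝ => u ^ 2) l atTop →
      Tendsto (fun u : ℝ => -(Complex.exp (-1 * ((u:ℂ) + ((-1:ℝ):ℂ) * Complex.I) ^ 2) *
      ((u:ℂ) + ((-1:ℝ):ℂ) * Complex.I)⁻¹)) l (𝓝 0) := by
    intro l hl
    refine squeeze_zero_norm (a := fun u => Real.exp (1 - u ^ 2)) (fun u => ?_) ?_
    · rw [norm_neg, norm_mul, norm_inv, w_gauss_norm]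
      exact mul_le_of_le_one_right (Real.exp_pos _).le (inv_le_one_of_one_le₀ (w_norm_ge u))
    · apply Real.tendsto_exp_atBot.comp
      exact tendsto_atBot_add_const_left _ _ (tendsto_neg_atTop_atBot.comp hl)
  have := integral_of_hasDerivAt_of_tendsto hd ((gauss_int.const_mul 2).add h0_int)
    (htop atBot (by simpa [Function.comp_def, sq_abs] using (tendsto_pow_atTop (α := ℝ) (n := 2) (by norm_num)).comp tendsto_abs_atBot_atTop)) (htop atTop (tendsto_pow_atTop (by norm_num)))
  rw [integral_add (gauss_int.const_mul 2) h0_int, integral_const_mul, gauss_val] at this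
  linear_combination this

theorem ptwise (d u : ℝ) (h0 : 0 < d) (h1 : d ≤ 1 / 2) (w : ℂ)
    (hw : w = (u:ℂ) + ((-1:ℝ):ℂ) * Complex.I) :
    ‖Complex.exp (-1 * w ^ 2) * (w ^ 2)⁻¹ *
      (Complex.exp (Complex.I * d * w ^ 3 / 3) * ((2 * Complex.I + d * w) ^ 2)⁻¹) -
      (-1 / 4) * (Complex.exp (-1 * w ^ 2) * (w ^ 2)⁻¹)‖
      ≤ d * (24 * Real.exp 1 * Real.exp (-(1/4) * u ^ 2)) := by
  have hwn : 1 ≤ ‖w‖ := hw ▸ w_norm_ge u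
  have hws : ‖w‖ ^ 2 = 1 + u ^ 2 := hw ▸ w_normsq u
  have hg : ‖Complex.exp (-1 * w ^ 2)‖ = Real.exp (1 - u ^ 2) := hw ▸ w_gauss_norm u
  have hq : 1 ≤ ‖2 * Complex.I + d * w‖ := by
    have : (2 * Complex.I + d * w).im = 2 - d := by
      rw [hw]; simp; ring
    calc (1:ℝ) ≤ 2 - d := by linarith
      _ = (2 * Complex.I + d * w).im := this.symm
      _ ≤ _ := Complex.im_le_norm _
  have hq0 : (2 * Complex.I + d * w) ≠ 0 := by
    intro h; rw [h] at hq; simp at hq; linarith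
  have hre : (Complex.I * d * w ^ 3 / 3).re ≤ u ^ 2 / 2 := by
    have : Complex.I * d * w ^ 3 / 3 = ((d * (u ^ 2 - 1 / 3) : ℝ) : ℂ) + ((d * (u ^ 3 / 3 - u) : ℝ) : ℂ) * Complex.I := by
      rw [hw]; push_cast
      linear_combination (-d * (u:ℂ)^2 + d * u * Complex.I - d / 3 * (Complex.I^2 - 1)) * Complex.I_sq
    rw [this]
    simp only [Complex.add_re, Complex.re_ofReal_mul, Complex.I_re, Complex.ofReal_re, mul_zero, add_zero]
    nlinarith [sq_nonneg u]
  have hE := norm_exp_sub_one _ _ (by positivity) hre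
  have hz : ‖Complex.I * d * w ^ 3 / 3‖ = d * ‖w‖ ^ 3 / 3 := by
    simp [abs_of_pos h0]
  rw [hz] at hE
  have hA : ‖(Complex.exp (Complex.I * d * w ^ 3 / 3) - 1) * ((2 * Complex.I + d * w) ^ 2)⁻¹‖
      ≤ Real.exp (u ^ 2 / 2) * (d * ‖w‖ ^ 3 / 3) := by
    rw [norm_mul, norm_inv, norm_pow]
    exact (mul_le_of_le_one_right (norm_nonneg _) (inv_le_one_of_one_le₀ (one_le_pow₀ hq))).trans hE
  have hB : ‖d * w * (4 * Complex.I + d * w) / 4 * ((2 * Complex.I + d * w) ^ 2)⁻¹‖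
      ≤ d * ‖w‖ * (5 * ‖w‖) / 4 := by
    rw [norm_mul, norm_inv, norm_pow]
    refine (mul_le_of_le_one_right (norm_nonneg _) (inv_le_one_of_one_le₀ (one_le_pow₀ hq))).trans ?_
    rw [norm_div, norm_mul, norm_mul]
    have : ‖4 * Complex.I + d * w‖ ≤ 5 * ‖w‖ := by
      refine (norm_add_le _ _).trans ?_
      simp [abs_of_pos h0]
      nlinarith
    simp only [Complex.norm_real, Real.norm_eq_abs, abs_of_pos h0, Complex.norm_ofNat]
    gcongr
  have key : Complex.exp (-1 * w ^ 2) * (w ^ 2)⁻¹ *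
      (Complex.exp (Complex.I * d * w ^ 3 / 3) * ((2 * Complex.I + d * w) ^ 2)⁻¹) -
      (-1 / 4) * (Complex.exp (-1 * w ^ 2) * (w ^ 2)⁻¹) =
      Complex.exp (-1 * w ^ 2) * (w ^ 2)⁻¹ *
      ((Complex.exp (Complex.I * d * w ^ 3 / 3) - 1) * ((2 * Complex.I + d * w) ^ 2)⁻¹ +
        d * w * (4 * Complex.I + d * w) / 4 * ((2 * Complex.I + d * w) ^ 2)⁻¹) := by
    have : ((2 * Complex.I + d * w) ^ 2)⁻¹ + 1 / 4 =
        d * w * (4 * Complex.I + d * w) / 4 * ((2 * Complex.I + d * w) ^ 2)⁻¹ := by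
      field_simp
      linear_combination 4 * Complex.I_sq
    rw [← this]; ring
  rw [key, norm_mul, norm_mul, norm_inv, norm_pow, hg]
  have hexp : 1 + u ^ 2 ≤ 8 * Real.exp (u ^ 2 / 8) := by
    have := Real.add_one_le_exp (u ^ 2 / 8)
    nlinarith
  have e1 : (1:ℝ) ≤ Real.exp (u ^ 2 / 2) := Real.one_le_exp (by positivity)
  have hwpos : 0 < ‖w‖ := by linarith
  calc _ ≤ Real.exp (1 - u ^ 2) * (‖w‖ ^ 2)⁻¹ *
        (Real.exp (u ^ 2 / 2) * (d * ‖w‖ ^ 3 / 3) + d * ‖w‖ * (5 * ‖w‖) / 4) := by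
        gcongr
        exact (norm_add_le _ _).trans (add_le_add hA hB)
    _ = Real.exp (1 - u ^ 2) * d * (Real.exp (u ^ 2 / 2) * ‖w‖ / 3 + 5 / 4) := by
        field_simp
    _ ≤ Real.exp (1 - u ^ 2) * d * (Real.exp (u ^ 2 / 2) * (24 * Real.exp (u ^ 2 / 8))) := by
        gcongr
        have e2 : ‖w‖ / 3 + 5 / 4 ≤ 24 * Real.exp (u ^ 2 / 8) := by nlinarith
        calc Real.exp (u ^ 2 / 2) * ‖w‖ / 3 + 5 / 4
            ≤ Real.exp (u ^ 2 / 2) * (‖w‖ / 3 + 5 / 4) := by nlinarith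
          _ ≤ _ := by gcongr
    _ = d * (24 * Real.exp (1 - u ^ 2 + u ^ 2 / 2 + u ^ 2 / 8)) := by
        rw [Real.exp_add, Real.exp_add]; ring
    _ ≤ d * (24 * Real.exp (1 + -(1/4) * u ^ 2)) := by
        have : 1 - u ^ 2 + u ^ 2 / 2 + u ^ 2 / 8 ≤ 1 + -(1/4) * u ^ 2 := by nlinarith [sq_nonneg u]
        have := Real.exp_le_exp.mpr this
        gcongr d * (24 * ?_)
    _ = _ := by rw [Real.exp_add]; ring

theorem algebra_id (d u : ℝ) (h0 : 0 < d) (h1 : d ≤ 1 / 2) (w : ℂ)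
    (hw : w = (u:ℂ) + ((-1:ℝ):ℂ) * Complex.I) :
    Complex.exp (Complex.I * ((1 / d ^ 2 : ℝ) : ℂ) * (((d * u : ℝ) + (1 - d : ℝ) * Complex.I : ℂ) +
      ((d * u : ℝ) + (1 - d : ℝ) * Complex.I : ℂ) ^ 3 / 3)) *
      ((1 + ((d * u : ℝ) + (1 - d : ℝ) * Complex.I : ℂ) ^ 2) ^ 2)⁻¹ =
    ((Real.exp (-2 / (3 * d ^ 2)) * (1 / d ^ 2) : ℝ) : ℂ) * (Complex.exp (-1 * w ^ 2) * (w ^ 2)⁻¹ *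
      (Complex.exp (Complex.I * d * w ^ 3 / 3) * ((2 * Complex.I + d * w) ^ 2)⁻¹)) := by
  have hd : (d:ℂ) ≠ 0 := by exact_mod_cast h0.ne'
  have ht : ((d * u : ℝ) + (1 - d : ℝ) * Complex.I : ℂ) = Complex.I + d * w := by
    rw [hw]; push_cast; ring
  rw [ht]
  have hs : (1 + (Complex.I + d * w) ^ 2) ^ 2 = d ^ 2 * (w ^ 2 * (2 * Complex.I + d * w) ^ 2) := by
    have : 1 + (Complex.I + d * w) ^ 2 = d * w * (2 * Complex.I + d * w) := by
      linear_combination Complex.I_sq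
    rw [this]; ring
  have he : Complex.I * ((1 / d ^ 2 : ℝ) : ℂ) * ((Complex.I + d * w) + (Complex.I + d * w) ^ 3 / 3)
      = ((-2 / (3 * d ^ 2) : ℝ) : ℂ) + -1 * w ^ 2 + Complex.I * d * w ^ 3 / 3 := by
    push_cast
    field_simp
    have h4 : Complex.I ^ 4 = 1 := Complex.I_pow_four
    have h3 : Complex.I ^ 3 = -Complex.I := Complex.I_pow_three
    ring_nf
    simp only [h4, h3, Complex.I_sq]
    ring
  rw [hs, he, Complex.exp_add, Complex.exp_add]
  push_cast
  rw [mul_inv, mul_inv]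
  ring

theorem oscInt_one_one_asymptotics :
    ∃ C : ℝ, 0 < C ∧ ∃ G₀ : ℝ, 1 ≤ G₀ ∧ ∀ G : ℝ, G₀ ≤ G →
      ‖oscInt G 1 1 -
          ((Real.sqrt Real.pi * (G / 2) ^ ((3 : ℝ) / 2) * Real.exp (-G ^ 3 / 3) : ℝ) : ℂ)‖
        ≤ C * Real.exp (-G ^ 3 / 3) := by
  have hMint : Integrable (fun u : ℝ => 24 * Real.exp 1 * Real.exp (-(1/4) * u ^ 2)) :=
    (integrable_exp_neg_mul_sq (by norm_num)).const_mul _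
  have hM0 : 0 ≤ ∫ u : ℝ, 24 * Real.exp 1 * Real.exp (-(1/4) * u ^ 2) :=
    integral_nonneg fun u => by positivity
  refine ⟨(∫ u : ℝ, 24 * Real.exp 1 * Real.exp (-(1/4) * u ^ 2)) + 1, by linarith, 2, by norm_num, ?_⟩
  intro G hG
  have hG3 : 4 ≤ G ^ 3 / 2 := by
    have : (2:ℝ) ^ 3 ≤ G ^ 3 := by gcongr
    linarith
  obtain ⟨d, hd0, hd⟩ : ∃ d : ℝ, 0 < d ∧ d ^ 2 = (G ^ 3 / 2)⁻¹ :=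
    ⟨Real.sqrt (G ^ 3 / 2)⁻¹, Real.sqrt_pos.mpr (by positivity), Real.sq_sqrt (by positivity)⟩
  have hL : 1 / d ^ 2 = G ^ 3 / 2 := by rw [hd]; simp
  have hd1 : d ≤ 1 / 2 := by
    have : d ^ 2 ≤ (4:ℝ)⁻¹ := by rw [hd]; gcongr
    nlinarith
  have hexpG : Real.exp (-G ^ 3 / 3) = Real.exp (-2 / (3 * d ^ 2)) := by
    congr 1
    have : -2 / (3 * d ^ 2) = -2 / 3 * (1 / d ^ 2) := by field_simp
    rw [this, hL]; ring
  have hmain : (G / 2) ^ ((3 : ℝ) / 2) = 1 / (2 * d) := by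
    have hG0 : 0 ≤ G / 2 := by linarith
    have h1 : ((G / 2) ^ ((3 : ℝ) / 2)) ^ 2 = (1 / (2 * d)) ^ 2 := by
      rw [← Real.rpow_natCast, ← Real.rpow_mul hG0]
      have : (1 / (2 * d)) ^ 2 = (1 / 4) * (1 / d ^ 2) := by field_simp; norm_num
      rw [this, hL]
      norm_num
      ring
    exact (pow_left_inj₀ (by positivity) (by positivity) two_ne_zero).mp h1
  set f : ℂ → ℂ := fun z => Complex.exp (Complex.I * ((1 / d ^ 2 : ℝ) : ℂ) * (z + z ^ 3 / 3)) *
      ((1 + z ^ 2) ^ 2)⁻¹ with hf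
  have hosc : oscInt G 1 1 = ∫ x : ℝ, f x := by
    unfold oscInt
    congr 1
    ext x
    rw [hf, hL]
    push_cast
    congr 2
    ring
  have hshift : (∫ x : ℝ, f x) = ∫ x : ℝ, f (x + (1 - d : ℝ) * Complex.I) := by
    refine shift_line f (1 - d) ((1 - (1 - d)) ^ 2)⁻¹ (by linarith) ?_ ?_
    · intro z hz0 hz1
      have : (1 + z ^ 2) ^ 2 ≠ 0 := by
        have hfac : 1 + z ^ 2 = (z - Complex.I) * (z + Complex.I) := by
          linear_combination Complex.I_sq
        rw [hfac]
        refine pow_ne_zero _ (mul_ne_zero ?_ ?_)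
        · intro h
          have := congrArg Complex.im h
          simp at this; linarith
        · intro h
          have := congrArg Complex.im h
          simp at this; linarith
      exact DifferentiableAt.mul (by fun_prop) (DifferentiableAt.inv (by fun_prop) this)
    · intro x y hy0 hy1
      exact phase_bound _ _ x y (by positivity) (by linarith) hy0 hy1
  have hscale : (∫ x : ℝ, f (x + (1 - d : ℝ) * Complex.I)) =
      d * ∫ u : ℝ, f ((d * u : ℝ) + (1 - d : ℝ) * Complex.I) := by
    have := Measure.integral_comp_mul_left (fun x : ℝ => f (x + (1 - d : ℝ) * Complex.I)) d
    rw [this, abs_of_pos (by positivity), Complex.real_smul]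
    have : (d:ℂ) ≠ 0 := by exact_mod_cast hd0.ne'
    push_cast
    field_simp
  set H : ℝ → ℂ := fun u => Complex.exp (-1 * ((u:ℂ) + ((-1:ℝ):ℂ) * Complex.I) ^ 2) *
      (((u:ℂ) + ((-1:ℝ):ℂ) * Complex.I) ^ 2)⁻¹ *
      (Complex.exp (Complex.I * d * ((u:ℂ) + ((-1:ℝ):ℂ) * Complex.I) ^ 3 / 3) *
        ((2 * Complex.I + d * ((u:ℂ) + ((-1:ℝ):ℂ) * Complex.I)) ^ 2)⁻¹) with hH
  have hfH : (∫ u : ℝ, f ((d * u : ℝ) + (1 - d : ℝ) * Complex.I)) =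
      ((Real.exp (-2 / (3 * d ^ 2)) * (1 / d ^ 2) : ℝ) : ℂ) * ∫ u : ℝ, H u := by
    rw [← integral_const_mul]
    congr 1
    ext u
    exact algebra_id d u hd0 hd1 _ rfl
  set H0 : ℝ → ℂ := fun u => (-1 / 4) * (Complex.exp (-1 * ((u:ℂ) + ((-1:ℝ):ℂ) * Complex.I) ^ 2) *
    (((u:ℂ) + ((-1:ℝ):ℂ) * Complex.I) ^ 2)⁻¹) with hH0
  have hH0int : Integrable H0 := h0_int.const_mul _
  have hH0val : ∫ u : ℝ, H0 u = ((Real.sqrt π / 2 : ℝ) : ℂ) := by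
    rw [hH0, integral_const_mul, h0_val]; push_cast; ring
  have hbd : ∀ u : ℝ, ‖H u - H0 u‖ ≤ d * (24 * Real.exp 1 * Real.exp (-(1/4) * u ^ 2)) :=
    fun u => ptwise d u hd0 hd1 _ rfl
  have hHc : Continuous H := by
    refine Continuous.mul (Continuous.mul (by fun_prop)
      (Continuous.inv₀ (by fun_prop) fun u => pow_ne_zero _ (w_ne u)))
      (Continuous.mul (by fun_prop) (Continuous.inv₀ (by fun_prop) fun u => pow_ne_zero _ ?_))
    intro h
    have := congrArg Complex.im h
    simp at this; linarith
  have hDint : Integrable (fun u => H u - H0 u) :=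
    (hMint.const_mul d).mono' (hHc.aestronglyMeasurable.sub hH0int.aestronglyMeasurable)
      (Eventually.of_forall hbd)
  have hHint : Integrable H := by
    have := hDint.add hH0int
    refine this.congr (Eventually.of_forall fun u => ?_)
    simp
  have hdiff : ‖(∫ u, H u) - ((Real.sqrt π / 2 : ℝ) : ℂ)‖ ≤
      d * ∫ u : ℝ, 24 * Real.exp 1 * Real.exp (-(1/4) * u ^ 2) := by
    rw [← hH0val, ← integral_sub hHint hH0int, ← integral_const_mul]
    exact norm_integral_le_of_norm_le (hMint.const_mul d) (Eventually.of_forall hbd)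
  have hfin : oscInt G 1 1 -
          ((Real.sqrt Real.pi * (G / 2) ^ ((3 : ℝ) / 2) * Real.exp (-G ^ 3 / 3) : ℝ) : ℂ) =
      ((Real.exp (-G ^ 3 / 3) * (1 / d) : ℝ) : ℂ) * ((∫ u, H u) - ((Real.sqrt π / 2 : ℝ) : ℂ)) := by
    rw [hosc, hshift, hscale, hfH, hmain, hexpG]
    have : (d:ℂ) ≠ 0 := by exact_mod_cast hd0.ne'
    push_cast
    field_simp
  rw [hfin, norm_mul, Complex.norm_real, Real.norm_of_nonneg (by positivity)]
  calc _ ≤ Real.exp (-G ^ 3 / 3) * (1 / d) *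
        (d * ∫ u : ℝ, 24 * Real.exp 1 * Real.exp (-(1/4) * u ^ 2)) := by gcongr
    _ = (∫ u : ℝ, 24 * Real.exp 1 * Real.exp (-(1/4) * u ^ 2)) * Real.exp (-G ^ 3 / 3) := by
        field_simp
    _ ≤ _ := by
        gcongr
        linarith
end

section
/- Let G > 0 and κ > 0 with κ < G³/3, and set w₊ = i(1/3 − κ G^{−3}) and w₋ = −i(1/3 − κ G^{−3}). Let D ⊂ ℂ be an open connected set containing w₊ and w₋. Let h : D × ℝ → ℂ be holomorphic in the first variable, C¹ in the second, 2π-periodic in the second variable, bounded with M := sup_{(w,ξ) ∈ D×ℝ} |h(w,ξ)| < ∞, and satisfying the transport equation ∂_w h(w,ξ) + G³ ∂_ξ h(w,ξ) = 0 on D × ℝ. Define the Fourier coefficients h^{[l]}(w) = (1/2π)∫₀^{2π} h(w,ξ) e^{−ilξ} dξ. Then for each l ∈ ℤ there exists β_l ∈ ℂ such that h^{[l]}(w) = β_l · e^{−i l G³ w} for all w ∈ D (so that formally h(w,ξ) = Σ_l β_l e^{il(ξ − G³ w)}), and the coefficients satisfy the exponentially small bounds |β_l| ≤ M · e^{|l|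 κ} · e^{−|l| G³/3}. -/
/- STATEMENT 13: a bounded holomorphic 2π-periodic solution of the transport
equation `∂_w h + G³ ∂_ξ h = 0` on a connected domain containing the points
`±i(1/3 − κG⁻³)` has Fourier coefficients of the form `β_l e^{−ilG³w}` with
exponentially small `|β_l| ≤ M e^{|l|κ} e^{−|l|G³/3}`. -/

open Real MeasureTheory

theorem exp_periodic_aux (l : ℤ) :
    Complex.exp (-Complex.I * l * ((2 * Real.pi : ℝ) : ℂ)) = 1 := by
  rw [Complex.exp_eq_one_iff]
  refine ⟨-l, ?_⟩
  push_cast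
  ring

theorem norm_exp_aux (l : ℤ) (x : ℝ) : ‖Complex.exp (-Complex.I * l * x)‖ = 1 := by
  rw [Complex.norm_exp]
  simp

theorem parts_aux (f : ℝ → ℂ) (hf : ContDiff ℝ 1 f) (hper : ∀ ξ, f (ξ + 2 * Real.pi) = f ξ)
    (l : ℤ) :
    ∫ ξ in (0 : ℝ)..(2 * Real.pi), deriv f ξ * Complex.exp (-Complex.I * l * ξ)
      = Complex.I * l * ∫ ξ in (0 : ℝ)..(2 * Real.pi), f ξ * Complex.exp (-Complex.I * l * ξ) := by
  have hf' : Continuous (deriv f) := hf.continuous_deriv le_rfl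
  have hv : ∀ x : ℝ, HasDerivAt (fun ξ : ℝ => Complex.exp (-Complex.I * l * ξ))
      (Complex.exp (-Complex.I * l * x) * (-Complex.I * l)) x := by
    intro x
    have h1 : HasDerivAt (fun ξ : ℝ => -Complex.I * l * (ξ : ℂ)) (-Complex.I * l * 1) x :=
      (Complex.ofRealCLM.hasDerivAt (x := x)).const_mul (-Complex.I * (l : ℂ))
    simpa using h1.cexp
  have key := intervalIntegral.integral_mul_deriv_eq_deriv_mul (a := 0) (b := 2 * Real.pi)
    (u := f) (u' := deriv f) (v := fun ξ : ℝ => Complex.exp (-Complex.I * l * ξ))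
    (v' := fun x => Complex.exp (-Complex.I * l * x) * (-Complex.I * l))
    (fun x _ => ((hf.differentiable one_ne_zero) x).hasDerivAt) (fun x _ => hv x)
    (hf'.intervalIntegrable _ _) (Continuous.intervalIntegrable (by fun_prop) _ _)
  have h0 : f (2 * Real.pi) = f 0 := by simpa using hper 0
  rw [exp_periodic_aux, h0] at key
  simp only [Complex.ofReal_zero, mul_zero, Complex.exp_zero, sub_self, zero_sub,
    ← mul_assoc, intervalIntegral.integral_mul_const] at key
  linear_combination key

theorem deriv_aux (g : ℂ)
    (D : Set ℂ) (hDopen : IsOpen D)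
    (h : ℂ → ℝ → ℂ)
    (hhol : ∀ ξ : ℝ, DifferentiableOn ℂ (fun w => h w ξ) D)
    (hC1 : ∀ w ∈ D, ContDiff ℝ 1 (h w))
    (hper : ∀ w ∈ D, ∀ ξ : ℝ, h w (ξ + 2 * Real.pi) = h w ξ)
    (M : ℝ) (hM : ∀ w ∈ D, ∀ ξ : ℝ, ‖h w ξ‖ ≤ M)
    (htrans : ∀ w ∈ D, ∀ ξ : ℝ,
      deriv (fun z => h z ξ) w + g * deriv (fun η => h w η) ξ = 0) (l : ℤ) (w : ℂ) (hw : w ∈ D) :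
    HasDerivAt (fun w => ∫ ξ in (0 : ℝ)..(2 * Real.pi), h w ξ * Complex.exp (-Complex.I * l * ξ))
      (-(Complex.I * l * g) *
        ∫ ξ in (0 : ℝ)..(2 * Real.pi), h w ξ * Complex.exp (-Complex.I * l * ξ)) w := by
  obtain ⟨r, hr, hrD⟩ := Metric.isOpen_iff.1 hDopen w hw
  have hexp : Continuous (fun ξ : ℝ => Complex.exp (-Complex.I * l * ξ)) := by fun_prop
  have hd : ∀ z ∈ D, ∀ ξ, deriv (fun z => h z ξ) z = -g * deriv (h z) ξ := by
    intro z hz ξ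
    have := htrans z hz ξ
    linear_combination this
  have hsub : ∀ z ∈ Metric.ball w (r / 3), Metric.closedBall z (r / 3) ⊆ D := by
    intro z hz y hy
    apply hrD
    rw [Metric.mem_ball] at *
    rw [Metric.mem_closedBall] at hy
    linarith [dist_triangle y z w]
  have key := intervalIntegral.hasDerivAt_integral_of_dominated_loc_of_deriv_le
    (μ := volume) (a := 0) (b := 2 * Real.pi)
    (F := fun w ξ => h w ξ * Complex.exp (-Complex.I * l * ξ))
    (F' := fun w ξ => deriv (fun z => h z ξ) w * Complex.exp (-Complex.I * l * ξ))
    (x₀ := w) (s := Metric.ball w (r / 3)) (bound := fun _ => M / (r / 3))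
    (Metric.ball_mem_nhds w (by positivity))
    (by
      filter_upwards [hDopen.mem_nhds hw] with z hz
      exact ((hC1 z hz).continuous.mul hexp).aestronglyMeasurable)
    (((hC1 w hw).continuous.mul hexp).intervalIntegrable _ _)
    (by
      simp only [hd w hw]
      exact ((continuous_const.mul ((hC1 w hw).continuous_deriv le_rfl)).mul
        hexp).aestronglyMeasurable)
    (by
      refine Filter.Eventually.of_forall fun ξ _ z hz => ?_
      rw [norm_mul, norm_exp_aux, mul_one]
      apply Complex.norm_deriv_le_of_forall_mem_sphere_norm_le (by positivity)
      · apply DifferentiableOn.diffContOnCl_ball (U := D) (hhol ξ) (hsub z hz)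
      · intro y hy
        exact hM y (hsub z hz (Metric.sphere_subset_closedBall hy)) ξ)
    intervalIntegrable_const
    (by
      refine Filter.Eventually.of_forall fun ξ _ z hz => ?_
      have hzD : z ∈ D := hsub z hz (Metric.mem_closedBall_self (by positivity))
      exact (((hhol ξ).differentiableAt (hDopen.mem_nhds hzD)).hasDerivAt).mul_const _)
  refine key.2.congr_deriv ?_
  simp only [hd w hw, mul_assoc, intervalIntegral.integral_const_mul]
  have := parts_aux (h w) (hC1 w hw) (hper w hw) l
  simp only [mul_assoc] at this
  rw [this]
  ring

theorem transport_fourier_decay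
    (G κ : ℝ) (hG : 0 < G) (hκ : 0 < κ) (hκG : κ < G ^ 3 / 3)
    (D : Set ℂ) (hDopen : IsOpen D) (hDconn : IsConnected D)
    (hwp : (Complex.I * ((1 / 3 - κ / G ^ 3 : ℝ) : ℂ)) ∈ D)
    (hwm : (-(Complex.I * ((1 / 3 - κ / G ^ 3 : ℝ) : ℂ))) ∈ D)
    (h : ℂ → ℝ → ℂ)
    (hhol : ∀ ξ : ℝ, DifferentiableOn ℂ (fun w => h w ξ) D)
    (hC1 : ∀ w ∈ D, ContDiff ℝ 1 (h w))
    (hper : ∀ w ∈ D, ∀ ξ : ℝ, h w (ξ + 2 * Real.pi) = h w ξ)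
    (M : ℝ) (hM : ∀ w ∈ D, ∀ ξ : ℝ, ‖h w ξ‖ ≤ M)
    (htrans : ∀ w ∈ D, ∀ ξ : ℝ,
      deriv (fun z => h z ξ) w + (G : ℂ) ^ 3 * deriv (fun η => h w η) ξ = 0) :
    ∀ l : ℤ, ∃ β : ℂ,
      (∀ w ∈ D,
        (1 / (2 * Real.pi) : ℂ) *
            (∫ ξ in (0 : ℝ)..(2 * Real.pi), h w ξ * Complex.exp (-Complex.I * l * ξ))
          = β * Complex.exp (-Complex.I * l * (G : ℂ) ^ 3 * w)) ∧
      ‖β‖ ≤ M * Real.exp (|(l : ℝ)| * κ) * Real.exp (-|(l : ℝ)| * G ^ 3 / 3) := by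
  intro l
  have hder := deriv_aux ((G : ℂ) ^ 3) D hDopen h hhol hC1 hper M hM htrans l
  set F : ℂ → ℂ := fun w =>
    ∫ ξ in (0 : ℝ)..(2 * Real.pi), h w ξ * Complex.exp (-Complex.I * l * ξ) with hF
  have hE : ∀ w ∈ D, HasDerivAt
      (fun w => (1 / (2 * Real.pi) : ℂ) * F w * Complex.exp (Complex.I * l * (G : ℂ) ^ 3 * w))
      0 w := by
    intro w hw
    have h1 : HasDerivAt (fun w : ℂ => Complex.I * l * (G : ℂ) ^ 3 * w)
        (Complex.I * l * (G : ℂ) ^ 3 * 1) w := (hasDerivAt_id w).const_mul _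
    refine (((hder w hw).const_mul (1 / (2 * Real.pi) : ℂ)).mul h1.cexp).congr_deriv ?_
    ring
  obtain ⟨β, hβ⟩ := hDopen.exists_is_const_of_deriv_eq_zero hDconn.isPreconnected
    (fun w hw => (hE w hw).differentiableAt.differentiableWithinAt) (fun w hw => (hE w hw).deriv)
  have hbd : ∀ w ∈ D, ‖(1 / (2 * Real.pi) : ℂ) * F w‖ ≤ M := by
    intro w hw
    have h1 : ‖F w‖ ≤ M * |2 * Real.pi - 0| := by
      apply intervalIntegral.norm_integral_le_of_norm_le_const
      intro ξ _
      rw [norm_mul, norm_exp_aux, mul_one]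
      exact hM w hw ξ
    have hpi := Real.pi_pos
    rw [sub_zero, abs_of_pos (by positivity)] at h1
    have h2 : ‖(1 / (2 * Real.pi) : ℂ)‖ = 1 / (2 * Real.pi) := by
      simp [abs_of_pos hpi]
    rw [norm_mul, h2, one_div_mul_eq_div, div_le_iff₀ (by positivity)]
    exact h1
  have hG3 : G ^ 3 * (1 / 3 - κ / G ^ 3) = G ^ 3 / 3 - κ := by
    field_simp
  have hb : ∀ w ∈ D, ‖β‖ ≤ M * Real.exp (-(l * G ^ 3 * w.im)) := by
    intro w hw
    rw [← hβ w hw, norm_mul, Complex.norm_exp]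
    have : (Complex.I * l * (G : ℂ) ^ 3 * w).re = -(l * G ^ 3 * w.im) := by
      have : Complex.I * l * (G : ℂ) ^ 3 * w = ((l * G ^ 3 : ℝ) : ℂ) * (Complex.I * w) := by
        push_cast; ring
      rw [this, Complex.re_ofReal_mul]
      simp
    rw [this]
    exact mul_le_mul_of_nonneg_right (hbd w hw) (Real.exp_pos _).le
  refine ⟨β, fun w hw => ?_, ?_⟩
  · rw [← hβ w hw, mul_assoc _ (Complex.exp _), ← Complex.exp_add]
    have : Complex.I * l * (G : ℂ) ^ 3 * w + -Complex.I * l * (G : ℂ) ^ 3 * w = 0 := by ring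
    rw [this, Complex.exp_zero, mul_one]
  · rw [mul_assoc, ← Real.exp_add]
    rcases le_total 0 (l : ℝ) with hl | hl
    · have := hb _ hwp
      rw [abs_of_nonneg hl]
      convert this using 3
      rw [Complex.im_mul_ofReal, Complex.I_im]
      linear_combination (l : ℝ) * hG3
    · have := hb _ hwm
      rw [abs_of_nonpos hl]
      convert this using 3
      rw [Complex.neg_im, Complex.im_mul_ofReal, Complex.I_im]
      linear_combination -(l : ℝ) * hG3
end
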